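/- arXiv:2405.20912 — 6 statements merged into one kernel-verified Lean document; each statement's English description precedes it below -/
import Mathlib

section
/- If λ : R → ℕ is feasible for the AMP, then the truncated vector λ' defined by λ' r = min (λ r) 1 is feasible for the AMP, is binary, and its cost satisfies ∑_{r∈R} c r * (λ' r) ≤ ∑_{r∈R} c r * (λ r). -/
/-- Truncating a natural-valued vector at `1` does not increase a sum with nonnegative weights. -/
theorem weighted_sum_truncation_le {R : Type*} [Fintype R] (w : R → ℝ) (hw : ∀ r, 0 ≤ w r)
    (x : R → ℕ) : ∑ r, w r * ((min (x r) 1 : ℕ) : ℝ) ≤ ∑ r, w r * (x r : ℝ) :=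
  Finset.sum_le_sum fun r _ =>
    mul_le_mul_of_nonneg_left (Nat.cast_le.mpr (min_le_left _ _)) (hw r)

/-- If `lam : R → ℕ` is feasible for the AMP, then the truncated vector
`fun r => min (lam r) 1` is feasible for the AMP, is binary, and its cost
does not exceed the cost of `lam`. -/
theorem amp_truncation_feasible_binary_cheaper
    {R I P : Type*} [Fintype R] [Fintype I] [Fintype P]
    (c : R → ℝ) (hc : ∀ r, 0 ≤ c r)
    (a : I → R → ℕ) (ha : ∀ i r, a i r ≤ 1)
    (b : P → R → ℝ) (hb : ∀ p r, 0 ≤ b p r)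
    (N : P → ℝ)
    (lam : R → ℕ)
    (hcov : ∀ i, 1 ≤ ∑ r, a i r * lam r)
    (hcap : ∀ p, ∑ r, b p r * (lam r : ℝ) ≤ N p) :
    (∀ i, 1 ≤ ∑ r, a i r * min (lam r) 1) ∧
    (∀ p, ∑ r, b p r * ((min (lam r) 1 : ℕ) : ℝ) ≤ N p) ∧
    (∀ r, min (lam r) 1 ≤ 1) ∧
    ∑ r, c r * ((min (lam r) 1 : ℕ) : ℝ) ≤ ∑ r, c r * (lam r : ℝ) := by
  refine ⟨fun i => ?_, fun p => (weighted_sum_truncation_le (b p) (hb p) lam).trans (hcap p),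
    fun r => min_le_right _ _, weighted_sum_truncation_le c hc lam⟩
  obtain ⟨r, hr, hne⟩ := Finset.exists_ne_zero_of_sum_ne_zero
    (Nat.one_le_iff_ne_zero.mp (hcov i))
  obtain ⟨har, hlr⟩ := mul_ne_zero_iff.mp hne
  have hpos : 1 ≤ a i r * min (lam r) 1 :=
    Nat.mul_pos (Nat.pos_of_ne_zero har) (lt_min (Nat.pos_of_ne_zero hlr) one_pos)
  exact hpos.trans
    (Finset.single_le_sum (f := fun r => a i r * min (lam r) 1) (fun _ _ => Nat.zero_le _) hr)
end

section
/- For any feasible instance of the AMP, there exists an optimal solution which is binary: if some λ₀ : R → ℕ is feasible for the AMP, then there exists a binary feasible λ* : R → ℕ such that ∑_{r∈R} c r * (λ* r) ≤ ∑_{r∈R} c r * (λ r) for every feasible λ : R → ℕ. -/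
/-- Truncating a multiplicity vector at `1` preserves every covering constraint. -/
theorem one_le_sum_mul_min_one {R : Type*} [Fintype R] {a lam : R → ℕ}
    (h : 1 ≤ ∑ r, a r * lam r) : 1 ≤ ∑ r, a r * min (lam r) 1 := by
  rw [Nat.one_le_iff_ne_zero] at h ⊢
  contrapose! h
  simpa [Finset.sum_eq_zero_iff] using h

/-- Truncating a multiplicity vector at `1` does not increase a nonnegative linear functional. -/
theorem sum_mul_min_one_le {R : Type*} [Fintype R] {w : R → ℝ} (hw : ∀ r, 0 ≤ w r)
    (lam : R → ℕ) : ∑ r, w r * ((min (lam r) 1 : ℕ) : ℝ) ≤ ∑ r, w r * (lam r : ℝ) :=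
  Finset.sum_le_sum fun r _ =>
    mul_le_mul_of_nonneg_left (Nat.cast_le.2 (min_le_left _ _)) (hw r)

/-- For any feasible instance of the AMP, there exists an optimal solution
which is binary. -/
theorem amp_exists_binary_optimal
    {R I P : Type*} [Fintype R] [Fintype I] [Fintype P]
    (c : R → ℝ) (hc : ∀ r, 0 ≤ c r)
    (a : I → R → ℕ) (ha : ∀ i r, a i r ≤ 1)
    (b : P → R → ℝ) (hb : ∀ p r, 0 ≤ b p r)
    (N : P → ℝ)
    (lam₀ : R → ℕ)
    (h₀cov : ∀ i, 1 ≤ ∑ r, a i r * lam₀ r)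
    (h₀cap : ∀ p, ∑ r, b p r * (lam₀ r : ℝ) ≤ N p) :
    ∃ lamStar : R → ℕ,
      (∀ r, lamStar r ≤ 1) ∧
      (∀ i, 1 ≤ ∑ r, a i r * lamStar r) ∧
      (∀ p, ∑ r, b p r * (lamStar r : ℝ) ≤ N p) ∧
      (∀ lam : R → ℕ,
        (∀ i, 1 ≤ ∑ r, a i r * lam r) →
        (∀ p, ∑ r, b p r * (lam r : ℝ) ≤ N p) →
        ∑ r, c r * (lamStar r : ℝ) ≤ ∑ r, c r * (lam r : ℝ)) := by
  let S : Set (R → ℕ) := {lam | (∀ r, lam r ≤ 1) ∧ (∀ i, 1 ≤ ∑ r, a i r * lam r) ∧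
    ∀ p, ∑ r, b p r * (lam r : ℝ) ≤ N p}
  have hS : S.Finite := (Set.Finite.pi' fun _ : R => Set.finite_Iic (1 : ℕ)).subset fun _ h => h.1
  have hmem : ∀ lam : R → ℕ, (∀ i, 1 ≤ ∑ r, a i r * lam r) →
      (∀ p, ∑ r, b p r * (lam r : ℝ) ≤ N p) → (fun r => min (lam r) 1) ∈ S :=
    fun lam hcov hcap => ⟨fun _ => min_le_right _ _, fun i => one_le_sum_mul_min_one (hcov i),
      fun p => (sum_mul_min_one_le (hb p) lam).trans (hcap p)⟩
  obtain ⟨lamStar, ⟨hbin, hcov, hcap⟩, hmin⟩ :=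
    Set.exists_min_image S (fun lam => ∑ r, c r * (lam r : ℝ)) hS ⟨_, hmem lam₀ h₀cov h₀cap⟩
  exact ⟨lamStar, hbin, hcov, hcap, fun lam hlcov hlcap =>
    (hmin _ (hmem lam hlcov hlcap)).trans (sum_mul_min_one_le hc lam)⟩
end

section
/- For every DMP-feasible integer solution μ : (Σ_{j∈J} S_j) → ℕ, the aggregated vector λ̂ : J → ℕ defined by λ̂ j = ∑_{s∈S_j} μ (j, s) is AMP-feasible with the same cost; that is: (i) ∑_{j∈J} a i j * λ̂ j ≥ 1 for every task i ∈ I; (ii) ∑_{j∈J} g j τ * ξ j k * λ̂ j ≤ N k for every skill level k ∈ K and time step τ ∈ T, where N k = ∑_{κ∈K, κ ≥ k} N^D κ; and (iii) ∑_{j∈J} c j * λ̂ j = ∑_{(j,s)} c j * μ (j, s). Hence for any feasible solution of the DMP there exists an equivalent feasible solution of the AMP. -/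
/-- For every DMP-feasible integer solution `μ` on the disaggregated team routes
`Σ j : J, S j`, the aggregated vector `fun j => ∑ s : S j, μ ⟨j, s⟩` is
AMP-feasible with the same cost. -/
theorem dmp_to_amp_aggregation
    {I T J : Type*} [Fintype I] [Fintype T] [Fintype J] {Kb : ℕ}
    (a : I → J → ℕ) (ha : ∀ i j, a i j ≤ 1)
    (g : J → T → ℕ) (hg : ∀ j τ, g j τ ≤ 1)
    (ξ : J → Fin Kb → ℕ) (c : J → ℝ)
    (S : J → Finset (Fin Kb → ℕ)) (hSne : ∀ j, (S j).Nonempty)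
    (hS : ∀ j, ∀ s ∈ S j, ∀ k : Fin Kb,
      ξ j k ≤ ∑ κ ∈ Finset.univ.filter (fun κ => k ≤ κ), s κ)
    (ND : Fin Kb → ℕ)
    (μ : (Σ j : J, (S j : Type _)) → ℕ)
    (hcov : ∀ i, 1 ≤ ∑ p : (Σ j : J, (S j : Type _)), a i p.1 * μ p)
    (hcap : ∀ (k : Fin Kb) (τ : T),
      ∑ p : (Σ j : J, (S j : Type _)), g p.1 τ * (p.2 : Fin Kb → ℕ) k * μ p ≤ ND k) :
    (∀ i, 1 ≤ ∑ j, a i j * (∑ s : (S j : Type _), μ ⟨j, s⟩)) ∧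
    (∀ (k : Fin Kb) (τ : T),
      ∑ j, g j τ * ξ j k * (∑ s : (S j : Type _), μ ⟨j, s⟩) ≤
        ∑ κ ∈ Finset.univ.filter (fun κ => k ≤ κ), ND κ) ∧
    (∑ j, c j * ((∑ s : (S j : Type _), μ ⟨j, s⟩ : ℕ) : ℝ) =
      ∑ p : (Σ j : J, (S j : Type _)), c p.1 * (μ p : ℝ)) := by
  refine ⟨fun i => ?_, fun k τ => ?_, ?_⟩
  · simpa only [Fintype.sum_sigma, Finset.mul_sum] using hcov i
  · calc ∑ j, g j τ * ξ j k * (∑ s : (S j : Type _), μ ⟨j, s⟩)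
        = ∑ p : (Σ j : J, (S j : Type _)), g p.1 τ * ξ p.1 k * μ p := by
          simp only [Fintype.sum_sigma, Finset.mul_sum]
      _ ≤ ∑ p : (Σ j : J, (S j : Type _)), g p.1 τ *
            (∑ κ ∈ Finset.univ.filter (fun κ => k ≤ κ), (p.2 : Fin Kb → ℕ) κ) * μ p := by
          gcongr with p
          exact hS p.1 p.2 p.2.2 k
      _ = ∑ κ ∈ Finset.univ.filter (fun κ => k ≤ κ),
            ∑ p : (Σ j : J, (S j : Type _)), g p.1 τ * (p.2 : Fin Kb → ℕ) κ * μ p := by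
          simp only [Finset.mul_sum, Finset.sum_mul]
          exact Finset.sum_comm
      _ ≤ ∑ κ ∈ Finset.univ.filter (fun κ => k ≤ κ), ND κ :=
          Finset.sum_le_sum fun κ _ => hcap κ τ
  · simp only [Fintype.sum_sigma, Nat.cast_sum, Finset.mul_sum]
end

section
/- (LP-relaxation version) For every real-valued DMP-feasible solution μ : (Σ_{j∈J} S_j) → ℝ with μ (j,s) ≥ 0 for all (j,s), the aggregated vector λ̂ : J → ℝ defined by λ̂ j = ∑_{s∈S_j} μ (j, s) is nonnegative and AMP-feasible with the same cost; that is: λ̂ j ≥ 0 for all j; ∑_{j∈J} a i j * λ̂ j ≥ 1 for every task i ∈ I; ∑_{j∈J} g j τ * ξ j k * λ̂ j ≤ N k for every skill level k ∈ K and time step τ ∈ T, where N k = ∑_{κ∈K, κ ≥ k} N^D κ; and ∑_{j∈J} c j * λ̂ j = ∑_{(j,s)} c j * μ (j, s). -/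
/-- LP-relaxation version: for every nonnegative real DMP-feasible solution `μ`
on `Σ j : J, S j`, the aggregated vector `fun j => ∑ s : S j, μ ⟨j, s⟩` is
nonnegative and AMP-feasible with the same cost. -/
theorem dmp_to_amp_aggregation_lp
    {I T J : Type*} [Fintype I] [Fintype T] [Fintype J] {Kb : ℕ}
    (a : I → J → ℕ) (ha : ∀ i j, a i j ≤ 1)
    (g : J → T → ℕ) (hg : ∀ j τ, g j τ ≤ 1)
    (ξ : J → Fin Kb → ℕ) (c : J → ℝ)
    (S : J → Finset (Fin Kb → ℕ)) (hSne : ∀ j, (S j).Nonempty)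
    (hS : ∀ j, ∀ s ∈ S j, ∀ k : Fin Kb,
      ξ j k ≤ ∑ κ ∈ Finset.univ.filter (fun κ => k ≤ κ), s κ)
    (ND : Fin Kb → ℕ)
    (μ : (Σ j : J, (S j : Type _)) → ℝ)
    (hnn : ∀ p, 0 ≤ μ p)
    (hcov : ∀ i, 1 ≤ ∑ p : (Σ j : J, (S j : Type _)), (a i p.1 : ℝ) * μ p)
    (hcap : ∀ (k : Fin Kb) (τ : T),
      ∑ p : (Σ j : J, (S j : Type _)),
        (g p.1 τ : ℝ) * ((p.2 : Fin Kb → ℕ) k : ℝ) * μ p ≤ (ND k : ℝ)) :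
    (∀ j, 0 ≤ ∑ s : (S j : Type _), μ ⟨j, s⟩) ∧
    (∀ i, 1 ≤ ∑ j, (a i j : ℝ) * (∑ s : (S j : Type _), μ ⟨j, s⟩)) ∧
    (∀ (k : Fin Kb) (τ : T),
      ∑ j, (g j τ : ℝ) * (ξ j k : ℝ) * (∑ s : (S j : Type _), μ ⟨j, s⟩) ≤
        ((∑ κ ∈ Finset.univ.filter (fun κ => k ≤ κ), ND κ : ℕ) : ℝ)) ∧
    (∑ j, c j * (∑ s : (S j : Type _), μ ⟨j, s⟩) =
      ∑ p : (Σ j : J, (S j : Type _)), c p.1 * μ p) := by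
  have sum_fiber (w : J → ℝ) : ∑ j, w j * (∑ s : (S j : Type _), μ ⟨j, s⟩) =
      ∑ p : (Σ j : J, (S j : Type _)), w p.1 * μ p := by
    rw [Fintype.sum_sigma]
    simp only [Finset.mul_sum]
  refine ⟨fun j => Finset.sum_nonneg fun s _ => hnn _, fun i => ?_, fun k τ => ?_, sum_fiber c⟩
  · rw [sum_fiber fun j => (a i j : ℝ)]
    exact hcov i
  · rw [sum_fiber fun j => (g j τ : ℝ) * (ξ j k : ℝ)]
    push_cast
    refine le_trans ?_ (Finset.sum_le_sum fun κ _ => hcap κ τ)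
    rw [Finset.sum_comm]
    refine Finset.sum_le_sum fun p _ => ?_
    rw [← Finset.sum_mul, ← Finset.mul_sum]
    have hξ : (ξ p.1 k : ℝ) ≤
        ∑ κ ∈ Finset.univ.filter (fun κ => k ≤ κ), ((p.2 : Fin Kb → ℕ) κ : ℝ) := by
      exact_mod_cast hS p.1 p.2 p.2.2 k
    exact mul_le_mul_of_nonneg_right (mul_le_mul_of_nonneg_left hξ (Nat.cast_nonneg _)) (hnn p)
end

section
/- (Single skill level regrouping) Let R be a finite set of tours with tl r ≤ tr r for all r ∈ R, demands d : R → ℕ, and a capacity N ∈ ℕ such that for every time τ ∈ ℕ one has ∑_{r∈R with tl r ≤ τ ≤ tr r} d r ≤ N. Then there exist x₀ : R → ℕ (workers sent from the depot to each tour), x₁ : R → ℕ (workers returning from each tour to the depot), y : R → R → ℕ with y ρ r = 0 whenever ¬(tr ρ ≤ tl r) (workers regrouped between tours), and z ∈ ℕ (workers staying at the depot), such that for every r ∈ R: x₀ r + ∑_{ρ∈R with tr ρ ≤ tl r} y ρ r = d r and x₁ r + ∑_{φ∈R with tr r ≤ tl φ} y r φ = d r, and moreover z + ∑_{r∈R}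 x₀ r = N and z + ∑_{r∈R} x₁ r = N. -/
/-- A natural number bounded by a finite sum is the sum of a family dominated termwise. -/
theorem exists_le_sum_eq {ι : Type*} (s : Finset ι) (u : ι → ℕ) (m : ℕ)
    (hm : m ≤ ∑ i ∈ s, u i) : ∃ w : ι → ℕ, w ≤ u ∧ ∑ i ∈ s, w i = m := by
  classical
  induction s using Finset.induction_on generalizing m with
  | empty => exact ⟨0, fun _ => Nat.zero_le _, by simpa using (hm.antisymm (Nat.zero_le _)).symm⟩
  | insert a s ha ih =>
    rw [Finset.sum_insert ha] at hm
    obtain ⟨w, hw, hsum⟩ := ih (m - min m (u a)) (by omega)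
    refine ⟨Function.update w a (min m (u a)),
      update_le_iff.2 ⟨min_le_right _ _, fun i _ => hw i⟩, ?_⟩
    rw [Finset.sum_insert ha, Finset.sum_update_of_notMem ha, hsum, Function.update_self]
    omega

/-- Greedy regrouping of the tours in `S`, in which workers only move on to tours starting
strictly after their previous tour ended. -/
theorem exists_regrouping_on {R : Type*} [Fintype R] [DecidableEq R]
    (tl tr : R → ℕ) (d : R → ℕ) (N : ℕ) (htltr : ∀ r, tl r ≤ tr r)
    (hcap : ∀ τ : ℕ,
      ∑ r ∈ Finset.univ.filter (fun r => tl r ≤ τ ∧ τ ≤ tr r), d r ≤ N) (S : Finset R) :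
    ∃ (x₀ x₁ : R → ℕ) (y : R → R → ℕ) (z : ℕ),
      (∀ ρ r, ¬ tr ρ < tl r → y ρ r = 0) ∧
      (∀ r, x₀ r + ∑ ρ, y ρ r = if r ∈ S then d r else 0) ∧
      (∀ r, x₁ r + ∑ φ, y r φ = if r ∈ S then d r else 0) ∧
      z + ∑ r, x₀ r = N ∧ z + ∑ r, x₁ r = N := by
  induction S using Finset.induction_on_max_value tl with
  | empty => exact ⟨0, 0, 0, N, by simp⟩
  | insert a S ha hmax ih =>
    obtain ⟨x₀, x₁, y, z, hy, hin, hout, hz₀, hz₁⟩ := ih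
    have hfree : d a ≤ z + ∑ r, (if tr r < tl a then x₁ r else 0) := by
      have hsplit : ∑ r, x₁ r + d a ≤ ∑ r, (if tr r < tl a then x₁ r else 0) +
          ∑ r, (if tl r ≤ tl a ∧ tl a ≤ tr r then d r else 0) := by
        have hda : d a = ∑ r, (if r = a then d a else 0) := by simp
        rw [hda, ← Finset.sum_add_distrib, ← Finset.sum_add_distrib]
        refine Finset.sum_le_sum fun r _ => ?_
        have h₁ := hout r
        have h₂ := hmax r
        have h₃ := htltr a
        by_cases hra : r = a
        · subst hra
          simp only [ha, if_false] at h₁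
          simp [h₃]
          omega
        · by_cases hS : r ∈ S
          · have := h₂ hS
            simp only [hS, if_true] at h₁
            simp only [hra, if_false]
            split_ifs <;> omega
          · simp only [hS, if_false] at h₁
            simp only [hra, if_false]
            omega
      have := hcap (tl a)
      rw [Finset.sum_filter] at this
      omega
    obtain ⟨w, hw, hsum⟩ := exists_le_sum_eq Finset.univ
      (fun r => if tr r < tl a then x₁ r else 0) (d a - min (d a) z) (by omega)
    have hwx : ∀ r, w r ≤ x₁ r := fun r => (hw r).trans (by dsimp only; split_ifs <;> omega)
    have hwy : ∀ r, ¬ tr r < tl a → w r = 0 := fun r hr => by simpa [hr] using hw r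
    refine ⟨fun r => x₀ r + if r = a then min (d a) z else 0,
      fun r => x₁ r - w r + if r = a then d a else 0,
      fun ρ r => y ρ r + if r = a then w ρ else 0, z - min (d a) z, ?_, ?_, ?_, ?_, ?_⟩
    · intro ρ r h
      simp only [hy ρ r h]
      split_ifs with hra
      · subst hra
        simp [hwy ρ h]
      · rfl
    · intro r
      have h := hin r
      rw [Finset.sum_add_distrib]
      by_cases hra : r = a
      · subst hra
        simp only [ha, if_false] at h
        simp only [if_true, Finset.mem_insert_self, hsum]
        omega
      · simpa [hra] using h
    · intro r
      have h := hout r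
      have h' := hwx r
      simp only [Finset.sum_add_distrib, Finset.sum_ite_eq', Finset.mem_univ, if_true]
      by_cases hra : r = a
      · subst hra
        simp only [ha, if_false] at h
        simp only [if_true, Finset.mem_insert_self]
        omega
      · simp only [hra, if_false, Finset.mem_insert, false_or]
        omega
    · simp only [Finset.sum_add_distrib, Finset.sum_ite_eq', Finset.mem_univ, if_true]
      omega
    · have h : ∑ r, (x₁ r - w r) + ∑ r, w r = ∑ r, x₁ r := by
        rw [← Finset.sum_add_distrib]
        exact Finset.sum_congr rfl fun r _ => Nat.sub_add_cancel (hwx r)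
      simp only [Finset.sum_add_distrib, Finset.sum_ite_eq', Finset.mem_univ, if_true]
      omega

/-- Single skill level regrouping: if the demand occupied at every time step never
exceeds the capacity `N`, then there is an integral worker flow from the depot
through the tours and back to the depot meeting every tour's demand. -/
theorem single_level_regrouping
    {R : Type*} [Fintype R]
    (tl tr : R → ℕ) (htltr : ∀ r, tl r ≤ tr r)
    (d : R → ℕ) (N : ℕ)
    (hcap : ∀ τ : ℕ,
      ∑ r ∈ Finset.univ.filter (fun r => tl r ≤ τ ∧ τ ≤ tr r), d r ≤ N) :
    ∃ (x₀ x₁ : R → ℕ) (y : R → R → ℕ) (z : ℕ),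
      (∀ ρ r, ¬ (tr ρ ≤ tl r) → y ρ r = 0) ∧
      (∀ r, x₀ r + ∑ ρ ∈ Finset.univ.filter (fun ρ => tr ρ ≤ tl r), y ρ r = d r) ∧
      (∀ r, x₁ r + ∑ φ ∈ Finset.univ.filter (fun φ => tr r ≤ tl φ), y r φ = d r) ∧
      z + ∑ r, x₀ r = N ∧
      z + ∑ r, x₁ r = N := by
  classical
  obtain ⟨x₀, x₁, y, z, hy, hin, hout, hz₀, hz₁⟩ :=
    exists_regrouping_on tl tr d N htltr hcap Finset.univ
  have hy' : ∀ ρ r, ¬ tr ρ ≤ tl r → y ρ r = 0 := fun ρ r h => hy ρ r fun h' => h h'.le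
  refine ⟨x₀, x₁, y, z, hy', fun r => ?_, fun r => ?_, hz₀, hz₁⟩
  · rw [Finset.sum_filter_of_ne fun ρ _ h => not_imp_comm.1 (hy' ρ r) h]
    simpa using hin r
  · rw [Finset.sum_filter_of_ne fun φ _ h => not_imp_comm.1 (hy' r φ) h]
    simpa using hout r
end

section
/- (Integer DMP solutions pass the feasibility check) Let R̄ be a finite set of selected disaggregated team routes with tl r ≤ tr r for all r ∈ R̄, skill levels K finite, per-level demands s : R̄ → K → ℕ, profile requirements ξ : R̄ → K → ℕ with ξ r k ≤ ∑_{κ∈K, κ ≥ k} s r κ for all r and k, and per-level capacities N^D : K → ℕ, such that for every k ∈ K and every time τ ∈ ℕ one has ∑_{r∈R̄ with tl r ≤ τ ≤ tr r} s r k ≤ N^D k. Then for every k ∈ K there exist nonnegative integers x₀ᵏ : R̄ → ℕ, x₁ᵏ : R̄ → ℕ, yᵏ : R̄ → R̄ → ℕ with yᵏ ρ r = 0 whenever ¬(tr ρ ≤ tl r), and zᵏ ∈ ℕ, such that: (i) x₀ᵏ r + ∑_{ρ with tr ρ ≤ tl r} yᵏ ρ r = s r k for every r ∈ R̄; (ii)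 x₁ᵏ r + ∑_{φ with tr r ≤ tl φ} yᵏ r φ = s r k for every r ∈ R̄; (iii) zᵏ + ∑_{r∈R̄} x₀ᵏ r = N^D k; (iv) zᵏ + ∑_{r∈R̄} x₁ᵏ r = N^D k; and consequently (v) ∑_{κ∈K, κ ≥ k} ( x₀^κ r + ∑_{ρ with tr ρ ≤ tl r} y^κ ρ r ) ≥ ξ r k for every r ∈ R̄ and k ∈ K, i.e. the feasibility check network flow problem admits a solution with objective value 0. -/
/-- A family of natural numbers dominates a family with any prescribed smaller total. -/
theorem exists_le_sum_eq_of_le_sum {ι : Type*} [Fintype ι] (c : ι → ℕ) (m : ℕ)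
    (hm : m ≤ ∑ i, c i) : ∃ w : ι → ℕ, (∀ i, w i ≤ c i) ∧ ∑ i, w i = m := by
  classical
  induction m with
  | zero => exact ⟨fun _ => 0, fun _ => Nat.zero_le _, by simp⟩
  | succ m ih =>
    obtain ⟨w, hw, hsum⟩ := ih (by lia)
    obtain ⟨j, -, hj⟩ := Finset.exists_lt_of_sum_lt (s := Finset.univ) (f := w) (g := c) (by lia)
    refine ⟨fun i => w i + if i = j then 1 else 0, fun i => ?_, ?_⟩
    · dsimp only
      split_ifs with h
      · subst h; exact hj
      · exact hw i
    · simp [Finset.sum_add_distrib, hsum]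

/-- Greedy regrouping: if the intervals `[tl r, tr r]` with weights `a r` never load a point by
more than `N`, then enough weight can be passed on from finished intervals to later ones that at
most `N` units have to be supplied from outside. -/
theorem exists_interval_transfer {R : Type*} [Fintype R] (tl tr a : R → ℕ) (N : ℕ)
    (htltr : ∀ r, tl r ≤ tr r)
    (hcap : ∀ τ, ∑ r ∈ Finset.univ.filter (fun r => tl r ≤ τ ∧ τ ≤ tr r), a r ≤ N)
    (S : Finset R) :
    ∃ y : R → R → ℕ,
      (∀ ρ r, ¬ tr ρ ≤ tl r → y ρ r = 0) ∧
      (∀ ρ r, r ∉ S → y ρ r = 0) ∧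
      (∀ ρ, ∑ r, y ρ r ≤ a ρ) ∧
      (∀ r, ∑ ρ, y ρ r ≤ a r) ∧
      ∑ r ∈ S, a r ≤ N + ∑ ρ, ∑ r, y ρ r := by
  classical
  induction S using Finset.induction_on_max_value tl with
  | empty => exact ⟨fun _ _ => 0, by simp⟩
  | insert r S hr hmax ih =>
    obtain ⟨y, hpred, hsupp, hrow, hcol, htot⟩ := ih
    let P := S.filter (fun ρ => tr ρ ≤ tl r)
    let c : R → ℕ := fun ρ => if ρ ∈ P then a ρ - ∑ φ, y ρ φ else 0
    obtain ⟨w, hwc, hwsum⟩ :=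
      exists_le_sum_eq_of_le_sum c (min (a r) (∑ ρ, c ρ)) (min_le_right _ _)
    have htotal : ∑ ρ, ∑ φ, (y ρ φ + if φ = r then w ρ else 0)
        = ∑ ρ, ∑ φ, y ρ φ + ∑ ρ, w ρ := by
      simp [Finset.sum_add_distrib]
    refine ⟨fun ρ φ => y ρ φ + if φ = r then w ρ else 0, ?_, ?_, ?_, ?_, ?_⟩
    · intro ρ φ h
      have hw : φ = r → w ρ = 0 := by
        rintro rfl
        have := hwc ρ
        simpa [c, P, h] using this
      simpa [hpred ρ φ h] using hw
    · intro ρ φ h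
      rw [Finset.mem_insert, not_or] at h
      simp [hsupp ρ φ h.2, h.1]
    · intro ρ
      have h₁ := hwc ρ
      have h₂ := hrow ρ
      simp only [Finset.sum_add_distrib, Finset.sum_ite_eq', Finset.mem_univ, if_true]
      dsimp only [c] at h₁
      split_ifs at h₁ <;> lia
    · intro φ
      by_cases h : φ = r
      · subst h
        simp [hsupp _ φ hr, hwsum]
      · simpa [h] using hcol φ
    · rw [htotal, Finset.sum_insert hr, hwsum]
      rcases le_total (a r) (∑ ρ, c ρ) with h | h
      · rw [min_eq_left h]; lia
      rw [min_eq_right h]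
      have hP : ∑ ρ ∈ P, a ρ ≤ ∑ ρ, ∑ φ, y ρ φ + ∑ ρ, c ρ := by
        calc ∑ ρ ∈ P, a ρ ≤ ∑ ρ ∈ P, (∑ φ, y ρ φ + c ρ) := by
              refine Finset.sum_le_sum fun ρ hρ => ?_
              simp only [c, if_pos hρ]
              lia
          _ ≤ ∑ ρ, (∑ φ, y ρ φ + c ρ) :=
              Finset.sum_le_sum_of_subset (Finset.subset_univ _)
          _ = _ := Finset.sum_add_distrib
      have hactive : a r + ∑ ρ ∈ S.filter (fun ρ => ¬ tr ρ ≤ tl r), a ρ ≤ N := by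
        rw [← Finset.sum_insert (by simp [hr])]
        refine (Finset.sum_le_sum_of_subset fun ρ hρ => ?_).trans (hcap (tl r))
        simp only [Finset.mem_insert, Finset.mem_filter, Finset.mem_univ, true_and] at hρ ⊢
        rcases hρ with rfl | ⟨hρ, hlt⟩
        · exact ⟨le_rfl, htltr _⟩
        · exact ⟨hmax ρ hρ, by lia⟩
      have hsplit := Finset.sum_filter_add_sum_filter_not S (fun ρ => tr ρ ≤ tl r) a
      lia


/-- Integer DMP solutions pass the feasibility check: for each skill level there
is an integral worker flow through the selected routes meeting each route's
per-level demand, and consequently the aggregated profile requirements are met. -/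
theorem dmp_passes_feasibility_check
    {R K : Type*} [Fintype R] [Fintype K] [LinearOrder K]
    (tl tr : R → ℕ) (htltr : ∀ r, tl r ≤ tr r)
    (s : R → K → ℕ) (ξ : R → K → ℕ)
    (hξ : ∀ r k, ξ r k ≤ ∑ κ ∈ Finset.univ.filter (fun κ => k ≤ κ), s r κ)
    (ND : K → ℕ)
    (hcap : ∀ (k : K) (τ : ℕ),
      ∑ r ∈ Finset.univ.filter (fun r => tl r ≤ τ ∧ τ ≤ tr r), s r k ≤ ND k) :
    ∃ (x₀ x₁ : K → R → ℕ) (y : K → R → R → ℕ) (z : K → ℕ),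
      (∀ k ρ r, ¬ (tr ρ ≤ tl r) → y k ρ r = 0) ∧
      (∀ k r, x₀ k r + ∑ ρ ∈ Finset.univ.filter (fun ρ => tr ρ ≤ tl r), y k ρ r = s r k) ∧
      (∀ k r, x₁ k r + ∑ φ ∈ Finset.univ.filter (fun φ => tr r ≤ tl φ), y k r φ = s r k) ∧
      (∀ k, z k + ∑ r, x₀ k r = ND k) ∧
      (∀ k, z k + ∑ r, x₁ k r = ND k) ∧
      (∀ r k, ξ r k ≤ ∑ κ ∈ Finset.univ.filter (fun κ => k ≤ κ),
        (x₀ κ r + ∑ ρ ∈ Finset.univ.filter (fun ρ => tr ρ ≤ tl r), y κ ρ r)) := by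
  choose y hpred _ hrow hcol htot using fun k =>
    exists_interval_transfer tl tr (fun r => s r k) (ND k) htltr (hcap k) Finset.univ
  have hin : ∀ k r, ∑ ρ ∈ Finset.univ.filter (fun ρ => tr ρ ≤ tl r), y k ρ r = ∑ ρ, y k ρ r :=
    fun k r => Finset.sum_filter_of_ne fun ρ _ h => not_not.mp fun hn => h (hpred k ρ r hn)
  have hout : ∀ k r, ∑ φ ∈ Finset.univ.filter (fun φ => tr r ≤ tl φ), y k r φ = ∑ φ, y k r φ :=
    fun k r => Finset.sum_filter_of_ne fun φ _ h => not_not.mp fun hn => h (hpred k r φ hn)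
  have hx₀ : ∀ k, ∑ r, (s r k - ∑ ρ, y k ρ r) + ∑ ρ, ∑ r, y k ρ r = ∑ r, s r k := fun k => by
    rw [Finset.sum_comm (f := y k), ← Finset.sum_add_distrib]
    exact Finset.sum_congr rfl fun r _ => Nat.sub_add_cancel (hcol k r)
  have hx₁ : ∀ k, ∑ r, (s r k - ∑ φ, y k r φ) + ∑ ρ, ∑ r, y k ρ r = ∑ r, s r k := fun k => by
    rw [← Finset.sum_add_distrib]
    exact Finset.sum_congr rfl fun r _ => Nat.sub_add_cancel (hrow k r)
  have hdemand : ∀ k r, s r k - ∑ ρ, y k ρ r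
      + ∑ ρ ∈ Finset.univ.filter (fun ρ => tr ρ ≤ tl r), y k ρ r = s r k := fun k r => by
    rw [hin, Nat.sub_add_cancel (hcol k r)]
  refine ⟨fun k r => s r k - ∑ ρ, y k ρ r, fun k r => s r k - ∑ φ, y k r φ, y,
    fun k => ND k - ∑ r, (s r k - ∑ ρ, y k ρ r), hpred, hdemand, fun k r => ?_, fun k => ?_,
    fun k => ?_, fun r k => ?_⟩
  · rw [hout, Nat.sub_add_cancel (hrow k r)]
  · have := hx₀ k
    have := htot k
    lia
  · have := hx₀ k
    have := hx₁ k
    have := htot k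
    lia
  · simpa only [hdemand] using hξ r k
end
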